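/- Assume p ∤ r and p ∤ α. Let h = (h₁,h₂,h₃) with 0 ≤ h₁ < p^{m−1}(p−1), 0 ≤ h₂ < p^{m−1}, 0 ≤ h₃ < p be such that M₀ := [[−αr⁻¹, −pβr⁻¹],[−r⁻¹, −αr⁻¹]] ∈ (K_m∩S)·s^h, where s^h = s₁^{h₁}s₂^{h₂}s₃^{h₃} (such h exists and is unique). Then, writing x_h for the (1,1)-entry of s^h, τ_l(χ) = [G_l : T₀] · p^{l+2m} · μ(det s^h)·e(Tr s^h)·ψ(s^h) · (Σ_{0≤t<p^{n−m}} μ(1+p^m t)·λ(p^{2m} i₁ t)·e(p^m x_h t)) · (Σ_{0≤t<p^{n−m}} μ(1+p^m t)·λ(p^{2m} i₂ t)·e(p^m x_h t)), where χ = (μ∘det)·Ind_{T₀}^{G_l} ψ. (Theorem 3.6(2).) -/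

import Mathlib

noncomputable section
open Matrix Complex

/-- The additive character `x ↦ ζ_N^{r·x} = exp(2πi·r·x/N)` of `ZMod N`. -/
def aChar (N : ℕ) (r : ℤ) (x : ZMod N) : ℂ :=
  Complex.exp (2 * Real.pi * Complex.I * (r : ℂ) * (x.val : ℂ) / (N : ℂ))

/-- The Gauss sum `τ_l(χ) = Σ_{X ∈ GL₂(ℤ/N)} χ(X) e(Tr X)` with `e = aChar N r`. -/
def tauGL (N : ℕ) [NeZero N] (r : ℤ) (χ : GL (Fin 2) (ZMod N) → ℂ) : ℂ :=
  ∑ X : GL (Fin 2) (ZMod N), χ X * aChar N r (Matrix.trace X.val)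

/-- `(Ind_H^T ψ)(g) = |H|⁻¹ Σ_{x ∈ T, x g x⁻¹ ∈ H} ψ(x g x⁻¹)`; induction to the
full group is the case `T = Set.univ`. -/
def indC (N : ℕ) [NeZero N] (H T : Set (GL (Fin 2) (ZMod N)))
    (ψ : GL (Fin 2) (ZMod N) → ℂ) (g : GL (Fin 2) (ZMod N)) : ℂ :=
  (Nat.card H : ℂ)⁻¹ *
    ∑ x : GL (Fin 2) (ZMod N), T.indicator (fun y => H.indicator ψ (y * g * y⁻¹)) x

/-- The congruence set `K_k = {I + p^k B}` inside `GL₂(ℤ/p^l)`. -/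
def Kset (p l k : ℕ) : Set (GL (Fin 2) (ZMod (p ^ l))) :=
  {X | ∃ B : Matrix (Fin 2) (Fin 2) (ZMod (p ^ l)),
        X.val = 1 + ((p : ZMod (p ^ l)) ^ k) • B}

/-- `T₀ = {[[a, pβb+p^n c],[b, a+p^m d]]} ∩ GL₂(ℤ/p^l)`. -/
def T0beta (p l β m n : ℕ) : Set (GL (Fin 2) (ZMod (p ^ l))) :=
  {X | ∃ a b c d : ZMod (p ^ l),
    X.val = !![a, (p : ZMod (p ^ l)) * (β : ZMod (p ^ l)) * b + (p : ZMod (p ^ l)) ^ n * c;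
               b, a + (p : ZMod (p ^ l)) ^ m * d]}

/-- `N = {[[1+p^m a, p^n b],[p^m c, 1+p^m d]]}` inside `GL₂(ℤ/p^l)`. -/
def NsetX3 (p l m n : ℕ) : Set (GL (Fin 2) (ZMod (p ^ l))) :=
  {X | ∃ a b c d : ZMod (p ^ l),
    X.val = !![1 + (p : ZMod (p ^ l)) ^ m * a, (p : ZMod (p ^ l)) ^ n * b;
               (p : ZMod (p ^ l)) ^ m * c, 1 + (p : ZMod (p ^ l)) ^ m * d]}

/-- `S = {[[a, pβb],[b, a]]} ∩ GL₂(ℤ/p^l)`. -/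
def SsetB (p l β : ℕ) : Set (GL (Fin 2) (ZMod (p ^ l))) :=
  {X | ∃ a b : ZMod (p ^ l),
    X.val = !![a, (p : ZMod (p ^ l)) * (β : ZMod (p ^ l)) * b; b, a]}

lemma aChar_eq_stdAddChar (N : ℕ) [NeZero N] (r : ℤ) (x : ZMod N) :
    aChar N r x = ZMod.stdAddChar ((r : ZMod N) * x) := by
  have h : (r : ZMod N) * x = ((r * (x.val : ℤ) : ℤ) : ZMod N) := by simp
  rw [h, ZMod.stdAddChar_coe, aChar]
  push_cast
  congr 1
  ring

/-- Unfolding the Gauss sum of an induced class function to a sum over the inducing set. -/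
lemma tauGL_mul_indC (N : ℕ) [NeZero N] (r : ℤ) (μ : ZMod N → ℂ)
    (H : Set (GL (Fin 2) (ZMod N))) (ψ : GL (Fin 2) (ZMod N) → ℂ) :
    tauGL N r (fun X => μ X.val.det * indC N H Set.univ ψ X) =
      (Nat.card (GL (Fin 2) (ZMod N)) : ℂ) / (Nat.card H : ℂ) *
        ∑ Y, H.indicator ψ Y * (μ Y.val.det * aChar N r (trace Y.val)) := by
  have key : ∀ x : GL (Fin 2) (ZMod N),
      ∑ X : GL (Fin 2) (ZMod N), H.indicator ψ (x * X * x⁻¹) *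
        (μ X.val.det * aChar N r (trace X.val)) =
      ∑ Y, H.indicator ψ Y * (μ Y.val.det * aChar N r (trace Y.val)) := by
    intro x
    refine Fintype.sum_equiv (MulAut.conj x).toEquiv _ _ fun X => ?_
    have hdet : (x * X * x⁻¹).val.det = X.val.det := by
      simpa using Matrix.det_units_conj x X.val
    have htr : trace (x * X * x⁻¹).val = trace X.val := by
      simpa using Matrix.trace_units_conj x X.val
    simp only [MulEquiv.toEquiv_eq_coe, MulEquiv.coe_toEquiv, MulAut.conj_apply, hdet, htr]
  unfold tauGL indC
  simp only [Set.indicator_univ]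
  calc _ = (Nat.card H : ℂ)⁻¹ * ∑ x : GL (Fin 2) (ZMod N), ∑ X : GL (Fin 2) (ZMod N),
        H.indicator ψ (x * X * x⁻¹) * (μ X.val.det * aChar N r (trace X.val)) := by
        rw [Finset.sum_comm, Finset.mul_sum]
        refine Finset.sum_congr rfl fun X _ => ?_
        rw [← Finset.sum_mul]
        ring
    _ = _ := by
        simp only [key, Finset.sum_const, Finset.card_univ, nsmul_eq_mul, Nat.card_eq_fintype_card]
        ring

lemma submonoid_inv_mem_of_finite {G : Type*} [Group G] [Finite G] (H : Submonoid G) {x : G}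
    (hx : x ∈ H) : x⁻¹ ∈ H := by
  have h := pow_mem hx (orderOf x - 1)
  rwa [← inv_eq_of_mul_eq_one_right (a := x) (b := x ^ (orderOf x - 1))] at h
  rw [← pow_succ', Nat.sub_add_cancel (orderOf_pos x), pow_orderOf_eq_one]

lemma sum_range_mul_of_periodic {f : ℕ → ℂ} {k : ℕ} (hf : Function.Periodic f k) (q : ℕ) :
    ∑ t ∈ Finset.range (q * k), f t = q * ∑ t ∈ Finset.range k, f t := by
  induction q with
  | zero => simp
  | succ q ih =>
    have h : ∀ t, f (q * k + t) = f t := fun t => by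
      rw [add_comm]
      exact hf.nat_mul q t
    rw [add_mul, one_mul, Finset.sum_range_add, ih]
    simp only [h]
    push_cast
    ring

open Classical in
lemma sum_eq_sum_of_twist {G : Type*} [Group G] [Fintype G] (N : ℕ) [NeZero N]
    (f : G → ℂ) (v : ZMod N → ZMod N → ZMod N → ZMod N → G) (A B C D : G → ZMod N)
    {P : G → Prop} (hP : ∀ Y, P Y ↔ A Y = 0 ∧ B Y = 0 ∧ C Y = 0 ∧ D Y = 0)
    (h : ∀ Y a b c d, f (Y * v a b c d) = f Y *
      (ZMod.stdAddChar (a * A Y) * (ZMod.stdAddChar (b * B Y) *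
        (ZMod.stdAddChar (c * C Y) * ZMod.stdAddChar (d * D Y))))) :
    ∑ Y, f Y = ∑ Y with P Y, f Y := by
  have hN : (N : ℂ) ≠ 0 := Nat.cast_ne_zero.mpr (NeZero.ne N)
  have hsum : ∀ x : ZMod N, ∑ a : ZMod N, ZMod.stdAddChar (a * x) =
      if x = 0 then (N : ℂ) else 0 := fun x => by
    rw [AddChar.sum_mulShift x (ZMod.isPrimitive_stdAddChar N), ZMod.card]
    split_ifs <;> simp
  have hshift : ∀ a b c d, ∑ Y, f (Y * v a b c d) = ∑ Y, f Y := fun a b c d =>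
    Fintype.sum_equiv (Equiv.mulRight (v a b c d)) _ _ fun _ => rfl
  have h1 : (N : ℂ) ^ 4 * ∑ Y, f Y =
      ∑ Y, ∑ a, ∑ b, ∑ c, ∑ d, f (Y * v a b c d) := by
    rw [Finset.sum_comm]
    simp_rw [Finset.sum_comm (s := (Finset.univ : Finset G)), hshift]
    simp only [Finset.sum_const, Finset.card_univ, ZMod.card, nsmul_eq_mul]
    ring
  have h2 : ∀ Y, ∑ a, ∑ b, ∑ c, ∑ d, f (Y * v a b c d) = (N : ℂ) ^ 4 *
      if P Y then f Y else 0 := fun Y => by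
    simp only [hP, h, ← Finset.mul_sum, ← Finset.sum_mul, hsum]
    by_cases hA : A Y = 0 <;> by_cases hB : B Y = 0 <;> by_cases hC : C Y = 0 <;>
      by_cases hD : D Y = 0 <;> simp [hA, hB, hC, hD]
    ring
  rw [Finset.sum_filter]
  refine mul_left_cancel₀ (pow_ne_zero 4 hN) ?_
  rw [h1, Finset.mul_sum]
  exact Finset.sum_congr rfl fun Y _ => h2 Y

section PrimePower

variable {p l : ℕ}

lemma prime_pow_cast_eq_zero {k : ℕ} (hk : l ≤ k) : (p : ZMod (p ^ l)) ^ k = 0 := by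
  rw [← Nat.cast_pow, ZMod.natCast_eq_zero_iff]
  exact pow_dvd_pow p hk

lemma isUnit_one_add_pow_mul {k : ℕ} (hk : k ≠ 0) (x : ZMod (p ^ l)) :
    IsUnit (1 + (p : ZMod (p ^ l)) ^ k * x) := by
  refine IsNilpotent.isUnit_one_add ((Commute.all _ _).isNilpotent_mul_right ?_)
  exact IsNilpotent.pow_of_pos ⟨l, prime_pow_cast_eq_zero le_rfl⟩ hk

lemma map_one_of_map_mul_units {μ : ZMod (p ^ l) → ℂ}
    (hμmul : ∀ x y : ZMod (p ^ l), IsUnit x → IsUnit y → μ (x * y) = μ x * μ y)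
    (hμne : ∀ x : ZMod (p ^ l), IsUnit x → μ x ≠ 0) : μ 1 = 1 := by
  have h := hμmul 1 1 isUnit_one isUnit_one
  rw [mul_one] at h
  exact (mul_eq_left₀ (hμne 1 isUnit_one)).mp h.symm

/-- `T₀` as a submonoid of `GL₂(ℤ/p^l)`. -/
def T0Submonoid (p l β : ℕ) {m n : ℕ} (hmn : m ≤ n) (hnm : n ≤ m + 1) :
    Submonoid (GL (Fin 2) (ZMod (p ^ l))) where
  carrier := T0beta p l β m n
  one_mem' := ⟨1, 0, 0, 0, by simp [Matrix.one_fin_two]⟩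
  mul_mem' := by
    rintro X Y ⟨a, b, c, d, hX⟩ ⟨a', b', c', d', hY⟩
    obtain ⟨s, hs⟩ := pow_dvd_pow (p : ZMod (p ^ l)) hmn
    obtain ⟨t, ht⟩ := pow_dvd_pow (p : ZMod (p ^ l)) hnm
    rw [pow_succ] at ht
    refine ⟨a * a' + ((p : ZMod (p ^ l)) * β * b + (p : ZMod (p ^ l)) ^ n * c) * b', b * a' + (a + (p : ZMod (p ^ l)) ^ m * d) * b',
      a * c' + t * β * b * d' + c * (a' + (p : ZMod (p ^ l)) ^ m * d') - t * β * d * b',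
      s * (b * c' - c * b') + a * d' + d * a' + (p : ZMod (p ^ l)) ^ m * d * d', ?_⟩
    rw [Units.val_mul, hX, hY, Matrix.mul_fin_two]
    congr 1
    ext i j
    fin_cases i <;> fin_cases j
    · simp
    · simp
      linear_combination (β * b * d' - β * d * b') * ht
    · simp
    · simp
      linear_combination (b * c' - c * b') * hs

/-- The element `[[1 + p^m a, p^n b], [p^m c, 1 + p^m d]]` of `N`. -/
def Nelt {m n : ℕ} (hm : m ≠ 0) (hl : l = m + n) (a b c d : ZMod (p ^ l)) :
    GL (Fin 2) (ZMod (p ^ l)) :=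
  Matrix.GeneralLinearGroup.mk''
    !![1 + (p : ZMod (p ^ l)) ^ m * a, (p : ZMod (p ^ l)) ^ n * b;
       (p : ZMod (p ^ l)) ^ m * c, 1 + (p : ZMod (p ^ l)) ^ m * d] (by
    have h : (p : ZMod (p ^ l)) ^ m * (p : ZMod (p ^ l)) ^ n = 0 := by
      rw [← pow_add, prime_pow_cast_eq_zero hl.le]
    rw [Matrix.det_fin_two_of]
    convert (isUnit_one_add_pow_mul hm a).mul (isUnit_one_add_pow_mul hm d) using 1
    linear_combination (-b * c) * h)

@[simp]
lemma Nelt_val {m n : ℕ} (hm : m ≠ 0) (hl : l = m + n) (a b c d : ZMod (p ^ l)) :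
    (Nelt hm hl a b c d).val =
      !![1 + (p : ZMod (p ^ l)) ^ m * a, (p : ZMod (p ^ l)) ^ n * b;
         (p : ZMod (p ^ l)) ^ m * c, 1 + (p : ZMod (p ^ l)) ^ m * d] :=
  rfl

lemma Nelt_det {m n : ℕ} (hm : m ≠ 0) (hl : l = m + n) (a b c d : ZMod (p ^ l)) :
    (Nelt hm hl a b c d).val.det =
      (1 + (p : ZMod (p ^ l)) ^ m * a) * (1 + (p : ZMod (p ^ l)) ^ m * d) := by
  have h : (p : ZMod (p ^ l)) ^ m * (p : ZMod (p ^ l)) ^ n = 0 := by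
    rw [← pow_add, prime_pow_cast_eq_zero hl.le]
  rw [Nelt_val, Matrix.det_fin_two_of]
  linear_combination (-b * c) * h

lemma Nelt_mem_T0beta (β : ℕ) {m n : ℕ} (hm : m ≠ 0) (hl : l = m + n) (hnm : n ≤ m + 1)
    (a b c d : ZMod (p ^ l)) : Nelt hm hl a b c d ∈ T0beta p l β m n := by
  obtain ⟨t, ht⟩ := pow_dvd_pow (p : ZMod (p ^ l)) hnm
  rw [pow_succ] at ht
  refine ⟨1 + (p : ZMod (p ^ l)) ^ m * a, (p : ZMod (p ^ l)) ^ m * c, b - t * β * c, d - a, ?_⟩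
  rw [Nelt_val]
  ext i j
  fin_cases i <;> fin_cases j
  · simp
  · simp
    linear_combination -β * c * ht
  · simp
  · simp
    ring

lemma Nelt_val_eq_one_add {m n : ℕ} (hm : m ≠ 0) (hl : l = m + n) (hmn : m ≤ n)
    (a b c d : ZMod (p ^ l)) :
    ∃ B : Matrix (Fin 2) (Fin 2) (ZMod (p ^ l)),
      (Nelt hm hl a b c d).val = 1 + (p : ZMod (p ^ l)) ^ m • B := by
  obtain ⟨s, hs⟩ := pow_dvd_pow (p : ZMod (p ^ l)) hmn
  refine ⟨!![a, s * b; c, d], ?_⟩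
  rw [Nelt_val]
  ext i j
  fin_cases i <;> fin_cases j <;> simp [hs, mul_assoc]

/-- The entrywise congruences cutting out the coset of `N` on which the Gauss sum lives. -/
def GaussSupport (β n α : ℕ) (r : ℤ) (Y : GL (Fin 2) (ZMod (p ^ l))) : Prop :=
  (p : ZMod (p ^ l)) ^ n * (α + r * Y.val 0 0) = 0 ∧
  (p : ZMod (p ^ l)) ^ n * (1 + r * Y.val 1 0) = 0 ∧
  (p : ZMod (p ^ l)) ^ n * (p * β + r * Y.val 0 1) = 0 ∧
  (p : ZMod (p ^ l)) ^ n * (α + r * Y.val 1 1) = 0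

lemma GaussSupport.mul {β m n α : ℕ} {r : ℤ} (hl : l = m + n)
    {X Z : GL (Fin 2) (ZMod (p ^ l))} (hX : GaussSupport β n α r X)
    {B : Matrix (Fin 2) (Fin 2) (ZMod (p ^ l))} (hB : Z.val = 1 + (p : ZMod (p ^ l)) ^ m • B) :
    GaussSupport β n α r (X * Z) := by
  have h3 : (p : ZMod (p ^ l)) ^ m * (p : ZMod (p ^ l)) ^ n = 0 := by
    rw [← pow_add, prime_pow_cast_eq_zero hl.le]
  have hXZ : (X * Z).val = X.val + (p : ZMod (p ^ l)) ^ m • (X.val * B) := by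
    rw [Units.val_mul, hB, mul_add, mul_one, Matrix.mul_smul]
  obtain ⟨h00, h10, h01, h11⟩ := hX
  refine ⟨?_, ?_, ?_, ?_⟩ <;> rw [hXZ, Matrix.add_apply, Matrix.smul_apply, smul_eq_mul]
  · linear_combination h00 + r * (X.val * B) 0 0 * h3
  · linear_combination h10 + r * (X.val * B) 1 0 * h3
  · linear_combination h01 + r * (X.val * B) 0 1 * h3
  · linear_combination h11 + r * (X.val * B) 1 1 * h3

/-- `S` as a submonoid of `GL₂(ℤ/p^l)`. -/
def SSubmonoid (p l β : ℕ) : Submonoid (GL (Fin 2) (ZMod (p ^ l))) where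
  carrier := SsetB p l β
  one_mem' := ⟨1, 0, by simp [Matrix.one_fin_two]⟩
  mul_mem' := by
    rintro X Y ⟨a, b, hX⟩ ⟨a', b', hY⟩
    refine ⟨a * a' + (p : ZMod (p ^ l)) * β * b * b', b * a' + a * b', ?_⟩
    rw [Units.val_mul, hX, hY, Matrix.mul_fin_two]
    ext i j
    fin_cases i <;> fin_cases j <;> simp <;> ring

variable [Fact p.Prime]

lemma pow_mul_eq_zero_iff_exists {j k : ℕ} (h : j + k = l) (x : ZMod (p ^ l)) :
    (p : ZMod (p ^ l)) ^ j * x = 0 ↔ ∃ y, x = (p : ZMod (p ^ l)) ^ k * y := by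
  constructor
  · obtain ⟨v, rfl⟩ := ZMod.natCast_zmod_surjective x
    intro hx
    rw [← Nat.cast_pow, ← Nat.cast_mul, ZMod.natCast_eq_zero_iff, ← h, pow_add] at hx
    obtain ⟨y, rfl⟩ := Nat.dvd_of_mul_dvd_mul_left (pow_pos (Fact.out : p.Prime).pos j) hx
    exact ⟨y, by push_cast; rfl⟩
  · rintro ⟨y, rfl⟩
    rw [← mul_assoc, ← pow_add, prime_pow_cast_eq_zero h.ge, zero_mul]

lemma pow_mul_natCast_injOn {j k : ℕ} (h : j + k = l) {a b : ℕ} (ha : a < p ^ k)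
    (hb : b < p ^ k) (hab : (p : ZMod (p ^ l)) ^ j * a = (p : ZMod (p ^ l)) ^ j * b) :
    a = b := by
  rw [← Nat.cast_pow, ← Nat.cast_mul, ← Nat.cast_mul, ZMod.natCast_eq_natCast_iff, ← h,
    pow_add] at hab
  exact (Nat.ModEq.mul_left_cancel' (pow_pos (Fact.out : p.Prime).pos j).ne' hab).eq_of_lt_of_lt
    ha hb

lemma exists_natCast_lt {j k : ℕ} (h : j + k = l) (x : ZMod (p ^ l)) :
    ∃ t < p ^ k, (p : ZMod (p ^ l)) ^ j * x = (p : ZMod (p ^ l)) ^ j * (t : ZMod (p ^ l)) := by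
  obtain ⟨v, rfl⟩ := ZMod.natCast_zmod_surjective x
  refine ⟨v % p ^ k, Nat.mod_lt _ (pow_pos (Fact.out : p.Prime).pos k), ?_⟩
  rw [← Nat.cast_pow, ← Nat.cast_mul, ← Nat.cast_mul, ZMod.natCast_eq_natCast_iff, ← h, pow_add]
  exact (Nat.mod_modEq v (p ^ k)).symm.mul_left' (p ^ j)

lemma isUnit_intCast_of_not_dvd {r : ℤ} (hr : ¬ (p : ℤ) ∣ r) : IsUnit (r : ZMod (p ^ l)) := by
  rw [ZMod.coe_int_isUnit_iff_isCoprime]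
  push_cast
  exact ((Nat.prime_iff_prime_int.mp Fact.out).irreducible.coprime_iff_not_dvd.mpr hr).pow_left

lemma mul_mem_T0beta_iff {β m n : ℕ} (hmn : m ≤ n) (hnm : n ≤ m + 1)
    {X Y : GL (Fin 2) (ZMod (p ^ l))} (hY : Y ∈ T0beta p l β m n) :
    X * Y ∈ T0beta p l β m n ↔ X ∈ T0beta p l β m n := by
  refine ⟨fun h => ?_, fun h => (T0Submonoid p l β hmn hnm).mul_mem h hY⟩
  have := (T0Submonoid p l β hmn hnm).mul_mem h
    (submonoid_inv_mem_of_finite (T0Submonoid p l β hmn hnm) hY)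
  rwa [mul_inv_cancel_right] at this

/-- The factor contributed by one diagonal entry of an element of `N`. -/
def diagTwist (μ : ZMod (p ^ l) → ℂ) (r : ℤ) (m i : ℕ) (y a : ZMod (p ^ l)) : ℂ :=
  μ (1 + (p : ZMod (p ^ l)) ^ m * a) *
    ZMod.stdAddChar (N := p ^ l) ((p : ZMod (p ^ l)) ^ (2 * m) * i * a +
      r * ((p : ZMod (p ^ l)) ^ m * y * a))

lemma map_one_add_pow_mul {n α : ℕ} (hn : n ≠ 0) (hl : l ≤ 2 * n) {μ : ZMod (p ^ l) → ℂ}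
    (hμmul : ∀ x y : ZMod (p ^ l), IsUnit x → IsUnit y → μ (x * y) = μ x * μ y)
    (hμne : ∀ x : ZMod (p ^ l), IsUnit x → μ x ≠ 0)
    (hμ : μ (1 + (p : ZMod (p ^ l)) ^ n) =
      ZMod.stdAddChar (N := p ^ l) ((p : ZMod (p ^ l)) ^ n * (α : ZMod (p ^ l)))) (x : ZMod (p ^ l)) :
    μ (1 + (p : ZMod (p ^ l)) ^ n * x) = ZMod.stdAddChar (N := p ^ l) ((p : ZMod (p ^ l)) ^ n * α * x) := by
  have key : ∀ k : ℕ, μ (1 + (p : ZMod (p ^ l)) ^ n * k) =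
      ZMod.stdAddChar (N := p ^ l) ((p : ZMod (p ^ l)) ^ n * α * k) := by
    intro k
    induction k with
    | zero => simp [map_one_of_map_mul_units hμmul hμne]
    | succ k ih =>
      have h0 : (p : ZMod (p ^ l)) ^ n * (p : ZMod (p ^ l)) ^ n = 0 := by
        rw [← pow_add, prime_pow_cast_eq_zero (by omega)]
      have h1 : 1 + (p : ZMod (p ^ l)) ^ n * ((k + 1 : ℕ) : ZMod (p ^ l)) =
          (1 + (p : ZMod (p ^ l)) ^ n * k) * (1 + (p : ZMod (p ^ l)) ^ n) := by
        push_cast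
        linear_combination -(k : ZMod (p ^ l)) * h0
      have hu : IsUnit (1 + (p : ZMod (p ^ l)) ^ n) := by
        simpa using isUnit_one_add_pow_mul (p := p) (l := l) hn 1
      rw [h1, hμmul _ _ (isUnit_one_add_pow_mul hn _) hu, ih, hμ, ← AddChar.map_add_eq_mul]
      congr 1
      push_cast
      ring
  simpa using key x.val

lemma diagTwist_pow_mul {m n α : ℕ} (hl : l = m + n) (hmn : m ≤ n)
    {μ : ZMod (p ^ l) → ℂ}
    (hμN : ∀ x, μ (1 + (p : ZMod (p ^ l)) ^ n * x) =
      ZMod.stdAddChar (N := p ^ l) ((p : ZMod (p ^ l)) ^ n * α * x))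
    (r : ℤ) (i : ℕ) (y a : ZMod (p ^ l)) :
    diagTwist μ r m i y ((p : ZMod (p ^ l)) ^ (n - m) * a) =
      ZMod.stdAddChar (N := p ^ l) (a * ((p : ZMod (p ^ l)) ^ n * (α + r * y))) := by
  have h1 : (p : ZMod (p ^ l)) ^ m * (p : ZMod (p ^ l)) ^ (n - m) = (p : ZMod (p ^ l)) ^ n := by
    rw [← pow_add, Nat.add_sub_cancel' hmn]
  have h2 : (p : ZMod (p ^ l)) ^ (2 * m) * (p : ZMod (p ^ l)) ^ (n - m) = 0 := by
    rw [← pow_add, prime_pow_cast_eq_zero (by omega)]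
  rw [diagTwist, ← mul_assoc, h1, hμN, ← AddChar.map_add_eq_mul]
  congr 1
  linear_combination (i * a) * h2 + (r * y * a) * h1

lemma diagTwist_add_pow {m n α : ℕ} (hm : m ≠ 0) (hl : l = m + n) (hmn : m ≤ n)
    {μ : ZMod (p ^ l) → ℂ}
    (hμmul : ∀ x y : ZMod (p ^ l), IsUnit x → IsUnit y → μ (x * y) = μ x * μ y)
    (hμN : ∀ x, μ (1 + (p : ZMod (p ^ l)) ^ n * x) =
      ZMod.stdAddChar (N := p ^ l) ((p : ZMod (p ^ l)) ^ n * α * x))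
    {r : ℤ} (i : ℕ) {y : ZMod (p ^ l)} (hy : (p : ZMod (p ^ l)) ^ n * (α + r * y) = 0)
    (a : ZMod (p ^ l)) :
    diagTwist μ r m i y (a + (p : ZMod (p ^ l)) ^ (n - m)) = diagTwist μ r m i y a := by
  have h1 : (p : ZMod (p ^ l)) ^ m * (p : ZMod (p ^ l)) ^ (n - m) = (p : ZMod (p ^ l)) ^ n := by
    rw [← pow_add, Nat.add_sub_cancel' hmn]
  have h2 : (p : ZMod (p ^ l)) ^ (2 * m) * (p : ZMod (p ^ l)) ^ (n - m) = 0 := by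
    rw [← pow_add, prime_pow_cast_eq_zero (by omega)]
  have h3 : (p : ZMod (p ^ l)) ^ m * (p : ZMod (p ^ l)) ^ n = 0 := by
    rw [← pow_add, prime_pow_cast_eq_zero hl.le]
  have hu := isUnit_one_add_pow_mul (p := p) hm a
  obtain ⟨u, hu'⟩ := hu.exists_right_inv
  have h4 : 1 + (p : ZMod (p ^ l)) ^ m * (a + (p : ZMod (p ^ l)) ^ (n - m)) =
      (1 + (p : ZMod (p ^ l)) ^ m * a) * (1 + (p : ZMod (p ^ l)) ^ n * u) := by
    linear_combination h1 - (p : ZMod (p ^ l)) ^ n * hu'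
  rw [diagTwist, diagTwist, h4, hμmul _ _ hu (isUnit_one_add_pow_mul (by omega) u), hμN,
    mul_assoc, ← AddChar.map_add_eq_mul]
  congr 2
  linear_combination hy + (r * y) * h1 + i * h2 - (α * a * u) * h3 +
    (p : ZMod (p ^ l)) ^ n * α * hu'

lemma sum_range_diagTwist {m n α : ℕ} (hm : m ≠ 0) (hl : l = m + n) (hmn : m ≤ n)
    {μ : ZMod (p ^ l) → ℂ}
    (hμmul : ∀ x y : ZMod (p ^ l), IsUnit x → IsUnit y → μ (x * y) = μ x * μ y)
    (hμN : ∀ x, μ (1 + (p : ZMod (p ^ l)) ^ n * x) =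
      ZMod.stdAddChar (N := p ^ l) ((p : ZMod (p ^ l)) ^ n * α * x))
    {r : ℤ} (i : ℕ) {y : ZMod (p ^ l)} (hy : (p : ZMod (p ^ l)) ^ n * (α + r * y) = 0) :
    ∑ t ∈ Finset.range (p ^ n), diagTwist μ r m i y (t : ZMod (p ^ l)) =
      (p : ℂ) ^ m * ∑ t ∈ Finset.range (p ^ (n - m)), diagTwist μ r m i y (t : ZMod (p ^ l)) := by
  have hper : Function.Periodic (fun t : ℕ => diagTwist μ r m i y (t : ZMod (p ^ l)))
      (p ^ (n - m)) := fun t => by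
    simpa using diagTwist_add_pow hm hl hmn hμmul hμN i hy (t : ZMod (p ^ l))
  have h := sum_range_mul_of_periodic hper (p ^ m)
  rw [← pow_add, Nat.add_sub_cancel' hmn] at h
  simpa using h

/-- The summand of the Gauss sum over `T₀`, extended by zero. -/
def t0Summand (β m n : ℕ) (r : ℤ) (μ : ZMod (p ^ l) → ℂ)
    (ψ : GL (Fin 2) (ZMod (p ^ l)) → ℂ) (Y : GL (Fin 2) (ZMod (p ^ l))) : ℂ :=
  (T0beta p l β m n).indicator ψ Y * (μ Y.val.det * aChar (p ^ l) r (trace Y.val))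

lemma t0Summand_mul_Nelt {β m n i₁ i₂ : ℕ} (hm : m ≠ 0) (hl : l = m + n) (hmn : m ≤ n)
    (hnm : n ≤ m + 1) (r : ℤ) {μ : ZMod (p ^ l) → ℂ}
    (hμmul : ∀ x y : ZMod (p ^ l), IsUnit x → IsUnit y → μ (x * y) = μ x * μ y)
    {ψ : GL (Fin 2) (ZMod (p ^ l)) → ℂ}
    (hψmul : ∀ X Y : GL (Fin 2) (ZMod (p ^ l)),
      X ∈ T0beta p l β m n → Y ∈ T0beta p l β m n → ψ (X * Y) = ψ X * ψ Y)
    (hψN : ∀ a b c d : ZMod (p ^ l), ψ (Nelt hm hl a b c d) =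
      ZMod.stdAddChar (N := p ^ l) ((p : ZMod (p ^ l)) ^ (2 * m) * (i₁ * a + i₂ * d)) *
        ZMod.stdAddChar (N := p ^ l) ((p : ZMod (p ^ l)) ^ (m + 1) * β * c + (p : ZMod (p ^ l)) ^ n * b))
    (Y : GL (Fin 2) (ZMod (p ^ l))) (a b c d : ZMod (p ^ l)) :
    t0Summand β m n r μ ψ (Y * Nelt hm hl a b c d) = t0Summand β m n r μ ψ Y *
      (diagTwist μ r m i₁ (Y.val 0 0) a *
        (ZMod.stdAddChar (N := p ^ l) (b * ((p : ZMod (p ^ l)) ^ n * (1 + r * Y.val 1 0))) *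
        (ZMod.stdAddChar (N := p ^ l) (c * ((p : ZMod (p ^ l)) ^ m * (p * β + r * Y.val 0 1))) *
        diagTwist μ r m i₂ (Y.val 1 1) d))) := by
  have hV := Nelt_mem_T0beta β hm hl hnm a b c d
  unfold t0Summand
  by_cases hY : Y ∈ T0beta p l β m n
  · have hdet : μ (Y * Nelt hm hl a b c d).val.det = μ Y.val.det *
        (μ (1 + (p : ZMod (p ^ l)) ^ m * a) * μ (1 + (p : ZMod (p ^ l)) ^ m * d)) := by
      have ha := isUnit_one_add_pow_mul (p := p) hm a
      have hd := isUnit_one_add_pow_mul (p := p) hm d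
      rw [Units.val_mul, Matrix.det_mul, Nelt_det,
        hμmul _ _ ((Matrix.isUnit_iff_isUnit_det _).mp Y.isUnit) (ha.mul hd), hμmul _ _ ha hd]
    have htr : (r : ZMod (p ^ l)) * trace (Y * Nelt hm hl a b c d).val =
        r * trace Y.val + (r * ((p : ZMod (p ^ l)) ^ m * Y.val 0 0 * a) +
          r * ((p : ZMod (p ^ l)) ^ n * Y.val 1 0 * b) +
          r * ((p : ZMod (p ^ l)) ^ m * Y.val 0 1 * c) +
          r * ((p : ZMod (p ^ l)) ^ m * Y.val 1 1 * d)) := by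
      simp [Matrix.trace_fin_two, Matrix.mul_apply, Fin.sum_univ_two]
      ring
    have hchar : ZMod.stdAddChar (N := p ^ l) ((p : ZMod (p ^ l)) ^ (2 * m) * (i₁ * a + i₂ * d)) *
        ZMod.stdAddChar (N := p ^ l) ((p : ZMod (p ^ l)) ^ (m + 1) * β * c + (p : ZMod (p ^ l)) ^ n * b) *
        ZMod.stdAddChar (N := p ^ l) (r * ((p : ZMod (p ^ l)) ^ m * Y.val 0 0 * a) +
          r * ((p : ZMod (p ^ l)) ^ n * Y.val 1 0 * b) +
          r * ((p : ZMod (p ^ l)) ^ m * Y.val 0 1 * c) +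
          r * ((p : ZMod (p ^ l)) ^ m * Y.val 1 1 * d)) =
        ZMod.stdAddChar (N := p ^ l) ((p : ZMod (p ^ l)) ^ (2 * m) * i₁ * a +
          r * ((p : ZMod (p ^ l)) ^ m * Y.val 0 0 * a)) *
        ZMod.stdAddChar (N := p ^ l) (b * ((p : ZMod (p ^ l)) ^ n * (1 + r * Y.val 1 0))) *
        ZMod.stdAddChar (N := p ^ l) (c * ((p : ZMod (p ^ l)) ^ m * (p * β + r * Y.val 0 1))) *
        ZMod.stdAddChar (N := p ^ l) ((p : ZMod (p ^ l)) ^ (2 * m) * i₂ * d +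
          r * ((p : ZMod (p ^ l)) ^ m * Y.val 1 1 * d)) := by
      simp only [← AddChar.map_add_eq_mul]
      congr 1
      ring
    rw [Set.indicator_of_mem ((mul_mem_T0beta_iff hmn hnm hV).mpr hY), Set.indicator_of_mem hY,
      hψmul _ _ hY hV, hdet, hψN, aChar_eq_stdAddChar, aChar_eq_stdAddChar, htr,
      AddChar.map_add_eq_mul _ (r * trace Y.val), diagTwist, diagTwist]
    linear_combination (ψ Y * μ Y.val.det * μ (1 + (p : ZMod (p ^ l)) ^ m * a) *
      μ (1 + (p : ZMod (p ^ l)) ^ m * d) * ZMod.stdAddChar (N := p ^ l) (r * trace Y.val)) * hchar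
  · rw [Set.indicator_of_notMem (fun h => hY ((mul_mem_T0beta_iff hmn hnm hV).mp h)),
      Set.indicator_of_notMem hY]
    simp

lemma eq_Nelt_of_mem_T0beta {β m n : ℕ} (hm : m ≠ 0) (hl : l = m + n) (hnm : n ≤ m + 1)
    {Z : GL (Fin 2) (ZMod (p ^ l))} (hZ : Z ∈ T0beta p l β m n)
    {B : Matrix (Fin 2) (Fin 2) (ZMod (p ^ l))} (hB : Z.val = 1 + (p : ZMod (p ^ l)) ^ m • B) :
    ∃ a < p ^ n, ∃ b < p ^ m, ∃ c < p ^ n, ∃ d < p ^ n,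
      Z = Nelt hm hl (a : ZMod (p ^ l)) (b : ZMod (p ^ l)) (c : ZMod (p ^ l))
        (d : ZMod (p ^ l)) := by
  obtain ⟨t, ht⟩ := pow_dvd_pow (p : ZMod (p ^ l)) hnm
  rw [pow_succ] at ht
  obtain ⟨x, y, z, w, hxyzw⟩ := hZ
  have h00 : x = 1 + (p : ZMod (p ^ l)) ^ m * B 0 0 := by
    simpa [hxyzw] using congrFun (congrFun hB 0) 0
  have h10 : y = (p : ZMod (p ^ l)) ^ m * B 1 0 := by
    simpa [hxyzw] using congrFun (congrFun hB 1) 0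
  obtain ⟨a, ha, ha'⟩ := exists_natCast_lt hl.symm (B 0 0)
  obtain ⟨c, hc, hc'⟩ := exists_natCast_lt hl.symm (B 1 0)
  obtain ⟨b, hb, hb'⟩ := exists_natCast_lt (p := p) (l := l) (j := n) (k := m) (by omega)
    (t * β * B 1 0 + z)
  obtain ⟨d, hd, hd'⟩ := exists_natCast_lt hl.symm (B 0 0 + w)
  refine ⟨a, ha, b, hb, c, hc, d, hd, Units.ext ?_⟩
  rw [hxyzw, Nelt_val]
  ext i j
  fin_cases i <;> fin_cases j
  · simp
    linear_combination h00 + ha'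
  · simp
    linear_combination (p : ZMod (p ^ l)) * β * h10 + β * B 1 0 * ht + hb'
  · simp
    linear_combination h10 + hc'
  · simp
    linear_combination h00 + hd'

lemma Nelt_natCast_inj {m n : ℕ} (hm : m ≠ 0) (hl : l = m + n) {a b c d a' b' c' d' : ℕ}
    (ha : a < p ^ n) (hb : b < p ^ m) (hc : c < p ^ n) (hd : d < p ^ n)
    (ha' : a' < p ^ n) (hb' : b' < p ^ m) (hc' : c' < p ^ n) (hd' : d' < p ^ n)
    (h : Nelt hm hl (a : ZMod (p ^ l)) (b : ZMod (p ^ l)) (c : ZMod (p ^ l)) (d : ZMod (p ^ l)) =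
      Nelt hm hl (a' : ZMod (p ^ l)) (b' : ZMod (p ^ l)) (c' : ZMod (p ^ l)) (d' : ZMod (p ^ l))) :
    a = a' ∧ b = b' ∧ c = c' ∧ d = d' := by
  have hval := congrArg Units.val h
  rw [Nelt_val, Nelt_val] at hval
  have h00 := congrFun (congrFun hval 0) 0
  have h01 := congrFun (congrFun hval 0) 1
  have h10 := congrFun (congrFun hval 1) 0
  have h11 := congrFun (congrFun hval 1) 1
  simp only [of_apply, cons_val', cons_val_zero, cons_val_one, cons_val_fin_one,
    add_right_inj] at h00 h01 h10 h11
  exact ⟨pow_mul_natCast_injOn hl.symm ha ha' h00,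
    pow_mul_natCast_injOn (by omega) hb hb' h01,
    pow_mul_natCast_injOn hl.symm hc hc' h10, pow_mul_natCast_injOn hl.symm hd hd' h11⟩

lemma GaussSupport.exists_inv_mul_eq {β m n α : ℕ} {r : ℤ} (hr : ¬ (p : ℤ) ∣ r) (hl : l = m + n)
    {X Y : GL (Fin 2) (ZMod (p ^ l))} (hX : GaussSupport β n α r X)
    (hY : GaussSupport β n α r Y) :
    ∃ B : Matrix (Fin 2) (Fin 2) (ZMod (p ^ l)),
      (X⁻¹ * Y).val = 1 + (p : ZMod (p ^ l)) ^ m • B := by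
  obtain ⟨u, hu⟩ := (isUnit_intCast_of_not_dvd (l := l) hr).exists_left_inv
  have hdiff : ∀ e x y : ZMod (p ^ l), (p : ZMod (p ^ l)) ^ n * (e + r * x) = 0 →
      (p : ZMod (p ^ l)) ^ n * (e + r * y) = 0 → ∃ c, y - x = (p : ZMod (p ^ l)) ^ m * c := by
    intro e x y hx hy
    refine (pow_mul_eq_zero_iff_exists (j := n) (by omega) _).mp ?_
    linear_combination u * (hy - hx) - (p : ZMod (p ^ l)) ^ n * (y - x) * hu
  obtain ⟨c00, h00⟩ := hdiff _ _ _ hX.1 hY.1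
  obtain ⟨c10, h10⟩ := hdiff _ _ _ hX.2.1 hY.2.1
  obtain ⟨c01, h01⟩ := hdiff _ _ _ hX.2.2.1 hY.2.2.1
  obtain ⟨c11, h11⟩ := hdiff _ _ _ hX.2.2.2 hY.2.2.2
  have hYX : Y.val = X.val + (p : ZMod (p ^ l)) ^ m • !![c00, c01; c10, c11] := by
    ext i j
    fin_cases i <;> fin_cases j <;> simp [← h00, ← h01, ← h10, ← h11]
  refine ⟨(X⁻¹).val * !![c00, c01; c10, c11], ?_⟩
  rw [Units.val_mul, hYX, mul_add, ← Units.val_mul, inv_mul_cancel, Units.val_one,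
    Matrix.mul_smul]

open Classical in
lemma sum_gaussSupport_eq {β m n α : ℕ} {r : ℤ} (hr : ¬ (p : ℤ) ∣ r) (hm : m ≠ 0)
    (hl : l = m + n) (hmn : m ≤ n) (hnm : n ≤ m + 1) {X : GL (Fin 2) (ZMod (p ^ l))}
    (hX : GaussSupport β n α r X) (hXT : X ∈ T0beta p l β m n)
    (f : GL (Fin 2) (ZMod (p ^ l)) → ℂ) (hf : ∀ Y ∉ T0beta p l β m n, f Y = 0) :
    ∑ Y with GaussSupport β n α r Y, f Y =
      ∑ a ∈ Finset.range (p ^ n), ∑ b ∈ Finset.range (p ^ m), ∑ c ∈ Finset.range (p ^ n),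
        ∑ d ∈ Finset.range (p ^ n), f (X * Nelt hm hl (a : ZMod (p ^ l)) (b : ZMod (p ^ l))
          (c : ZMod (p ^ l)) (d : ZMod (p ^ l))) := by
  simp only [← Finset.sum_product']
  symm
  refine Finset.sum_of_injOn (fun t : ℕ × ℕ × ℕ × ℕ =>
    X * Nelt hm hl (t.1 : ZMod (p ^ l)) (t.2.1 : ZMod (p ^ l)) (t.2.2.1 : ZMod (p ^ l))
      (t.2.2.2 : ZMod (p ^ l))) ?_ ?_ ?_ (fun _ _ => rfl)
  · rintro ⟨a, b, c, d⟩ h ⟨a', b', c', d'⟩ h' heq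
    simp only [Finset.coe_product, Set.mem_prod, Finset.mem_coe, Finset.mem_range] at h h'
    obtain ⟨ha, hb, hc, hd⟩ := h
    obtain ⟨ha', hb', hc', hd'⟩ := h'
    obtain ⟨rfl, rfl, rfl, rfl⟩ :=
      Nelt_natCast_inj hm hl ha hb hc hd ha' hb' hc' hd' (mul_left_cancel heq)
    rfl
  · rintro t -
    obtain ⟨B, hB⟩ := Nelt_val_eq_one_add hm hl hmn (t.1 : ZMod (p ^ l))
      (t.2.1 : ZMod (p ^ l)) (t.2.2.1 : ZMod (p ^ l)) (t.2.2.2 : ZMod (p ^ l))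
    simpa using hX.mul hl hB
  · intro Y hY hnot
    by_contra hne
    have hYT : Y ∈ T0beta p l β m n := by
      by_contra h
      exact hne (hf Y h)
    obtain ⟨B, hB⟩ := hX.exists_inv_mul_eq hr hl (Finset.mem_filter.mp hY).2
    have hZ : X⁻¹ * Y ∈ T0beta p l β m n := (T0Submonoid p l β hmn hnm).mul_mem
      (submonoid_inv_mem_of_finite (T0Submonoid p l β hmn hnm) hXT) hYT
    obtain ⟨a, ha, b, hb, c, hc, d, hd, hZ'⟩ := eq_Nelt_of_mem_T0beta hm hl hnm hZ hB
    refine hnot ⟨(a, b, c, d), ?_, ?_⟩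
    · simp [ha, hb, hc, hd]
    · simp [← hZ']

lemma gaussSupport_of_eq_mul {β m n α : ℕ} {r : ℤ} (hr : ¬ (p : ℤ) ∣ r) (hl : l = m + n)
    {M Z X : GL (Fin 2) (ZMod (p ^ l))}
    (hM : M.val = !![-(α : ZMod (p ^ l)) * (r : ZMod (p ^ l))⁻¹,
        -(p : ZMod (p ^ l)) * (β : ZMod (p ^ l)) * (r : ZMod (p ^ l))⁻¹;
      -(r : ZMod (p ^ l))⁻¹, -(α : ZMod (p ^ l)) * (r : ZMod (p ^ l))⁻¹])
    (hZ : Z ∈ Kset p l m) (hMZ : M = Z * X) : GaussSupport β n α r X := by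
  obtain ⟨B, hB⟩ := hZ
  have h3 : (p : ZMod (p ^ l)) ^ m * (p : ZMod (p ^ l)) ^ n = 0 := by
    rw [← pow_add, prime_pow_cast_eq_zero hl.le]
  have hrr := ZMod.mul_inv_of_unit _ (isUnit_intCast_of_not_dvd (l := l) hr)
  have hX : M.val = X.val + (p : ZMod (p ^ l)) ^ m • (B * X.val) := by
    rw [hMZ, Units.val_mul, hB, add_mul, one_mul, Matrix.smul_mul]
  have hij : ∀ i j, X.val i j = M.val i j - (p : ZMod (p ^ l)) ^ m * (B * X.val) i j := by
    intro i j
    rw [hX]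
    simp
  refine ⟨?_, ?_, ?_, ?_⟩ <;> rw [hij, hM] <;> simp
  · linear_combination -(p : ZMod (p ^ l)) ^ n * α * hrr - r * (B * X.val) 0 0 * h3
  · linear_combination -(p : ZMod (p ^ l)) ^ n * hrr - r * (B * X.val) 1 0 * h3
  · linear_combination -(p : ZMod (p ^ l)) ^ n * p * β * hrr - r * (B * X.val) 0 1 * h3
  · linear_combination -(p : ZMod (p ^ l)) ^ n * α * hrr - r * (B * X.val) 1 1 * h3

end PrimePower

/-- Theorem 3.6(2): for `χ = (μ∘det)·Ind_{T₀}^{G_l} ψ` of degree `p^{l-2}(p²-1)`,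
`p ∤ r` and `p ∤ α`, with `h = (h₁,h₂,h₃)` the unique index triple such that
`M₀ = [[−αr⁻¹, −pβr⁻¹],[−r⁻¹, −αr⁻¹]] ∈ (K_m∩S)·s^h`, one has
`τ_l(χ) = [G_l:T₀]·p^{l+2m}·μ(det s^h)·e(Tr s^h)·ψ(s^h)·(Σ_t μ(1+p^m t)λ(p^{2m}i₁t)e(p^m x_h t))·(Σ_t μ(1+p^m t)λ(p^{2m}i₂t)e(p^m x_h t))`. -/
theorem gauss_sum_X3 (p l m n : ℕ) [Fact p.Prime] (hp : Odd p) (hl : 2 ≤ l)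
    (hm : m = l / 2) (hn : n = l - l / 2)
    (r : ℤ) (hr : ¬ ((p : ℤ) ^ l ∣ r)) (hpr : ¬ ((p : ℤ) ∣ r))
    (α β : ℕ) (hα : α < p ^ m) (hβ : β < p ^ (m - 1)) (hpα : ¬ p ∣ α)
    (i₁ i₂ : ℕ) (hi₁ : i₁ < p ^ (n - m)) (hi₂ : i₂ < p ^ (n - m))
    (μ : ZMod (p ^ l) → ℂ)
    (hμmul : ∀ x y : ZMod (p ^ l), IsUnit x → IsUnit y → μ (x * y) = μ x * μ y)
    (hμne : ∀ x : ZMod (p ^ l), IsUnit x → μ x ≠ 0)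
    (hμ : μ (1 + (p : ZMod (p ^ l)) ^ n) =
      aChar (p ^ l) 1 ((p : ZMod (p ^ l)) ^ n * (α : ZMod (p ^ l))))
    (ψ : GL (Fin 2) (ZMod (p ^ l)) → ℂ)
    (hψmul : ∀ X Y : GL (Fin 2) (ZMod (p ^ l)),
      X ∈ T0beta p l β m n → Y ∈ T0beta p l β m n → ψ (X * Y) = ψ X * ψ Y)
    (hψne : ∀ X ∈ T0beta p l β m n, ψ X ≠ 0)
    (hψN : ∀ (a b c d : ZMod (p ^ l)) (X : GL (Fin 2) (ZMod (p ^ l))),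
      X.val = !![1 + (p : ZMod (p ^ l)) ^ m * a, (p : ZMod (p ^ l)) ^ n * b;
                 (p : ZMod (p ^ l)) ^ m * c, 1 + (p : ZMod (p ^ l)) ^ m * d] →
      ψ X = aChar (p ^ l) 1 ((p : ZMod (p ^ l)) ^ (2 * m) * ((i₁ : ZMod (p ^ l)) * a + (i₂ : ZMod (p ^ l)) * d)) *
        aChar (p ^ l) 1 ((p : ZMod (p ^ l)) ^ (m + 1) * (β : ZMod (p ^ l)) * c +
          (p : ZMod (p ^ l)) ^ n * b))
    (γ : (ZMod (p ^ l))ˣ) (hγgen : ∀ x : (ZMod (p ^ l))ˣ, x ∈ Subgroup.zpowers γ)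
    (hγ : (γ : ZMod (p ^ l)) ^ (p ^ (m - 1) * (p - 1)) = 1 + (p : ZMod (p ^ l)) ^ m)
    (s₁ s₂ s₃ : GL (Fin 2) (ZMod (p ^ l)))
    (hs₁ : s₁.val = !![(γ : ZMod (p ^ l)), 0; 0, (γ : ZMod (p ^ l))])
    (hs₂ : s₂.val = !![1, (p : ZMod (p ^ l)) ^ 2 * (β : ZMod (p ^ l)); (p : ZMod (p ^ l)), 1])
    (hs₃ : s₃.val = !![1, (p : ZMod (p ^ l)) * (β : ZMod (p ^ l)); 1, 1])
    (h₁ h₂ h₃ : ℕ) (hh₁ : h₁ < p ^ (m - 1) * (p - 1)) (hh₂ : h₂ < p ^ (m - 1)) (hh₃ : h₃ < p)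
    (sh : GL (Fin 2) (ZMod (p ^ l))) (hsh : sh = s₁ ^ h₁ * s₂ ^ h₂ * s₃ ^ h₃)
    (M₀ : GL (Fin 2) (ZMod (p ^ l)))
    (hM₀ : M₀.val = !![-(α : ZMod (p ^ l)) * (r : ZMod (p ^ l))⁻¹,
                       -(p : ZMod (p ^ l)) * (β : ZMod (p ^ l)) * (r : ZMod (p ^ l))⁻¹;
                       -(r : ZMod (p ^ l))⁻¹,
                       -(α : ZMod (p ^ l)) * (r : ZMod (p ^ l))⁻¹])
    (hM₀mem : ∃ Z ∈ Kset p l m ∩ SsetB p l β, M₀ = Z * sh) :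
    tauGL (p ^ l) r
      (fun X => μ X.val.det * indC (p ^ l) (T0beta p l β m n) Set.univ ψ X)
      = ((Nat.card (GL (Fin 2) (ZMod (p ^ l))) : ℂ) / (Nat.card (T0beta p l β m n) : ℂ)) *
          (p : ℂ) ^ (l + 2 * m) * μ sh.val.det *
          aChar (p ^ l) r (Matrix.trace sh.val) * ψ sh *
          (∑ t ∈ Finset.range (p ^ (n - m)),
            μ (1 + (p : ZMod (p ^ l)) ^ m * (t : ZMod (p ^ l))) *
              aChar (p ^ l) 1 ((p : ZMod (p ^ l)) ^ (2 * m) * (i₁ : ZMod (p ^ l)) * (t : ZMod (p ^ l))) *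
              aChar (p ^ l) r ((p : ZMod (p ^ l)) ^ m * sh.val 0 0 * (t : ZMod (p ^ l)))) *
          (∑ t ∈ Finset.range (p ^ (n - m)),
            μ (1 + (p : ZMod (p ^ l)) ^ m * (t : ZMod (p ^ l))) *
              aChar (p ^ l) 1 ((p : ZMod (p ^ l)) ^ (2 * m) * (i₂ : ZMod (p ^ l)) * (t : ZMod (p ^ l))) *
              aChar (p ^ l) r ((p : ZMod (p ^ l)) ^ m * sh.val 0 0 * (t : ZMod (p ^ l)))) := by
  have hm0 : m ≠ 0 := by omega
  have hn0 : n ≠ 0 := by omega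
  have hl' : l = m + n := by omega
  have hmn : m ≤ n := by omega
  have hnm : n ≤ m + 1 := by omega
  obtain ⟨Z, hZ, hMZ⟩ := hM₀mem
  have hS : sh ∈ SsetB p l β := by
    have h1 : s₁ ∈ SSubmonoid p l β := ⟨γ, 0, by simp [hs₁]⟩
    have h2 : s₂ ∈ SSubmonoid p l β := ⟨1, p, by rw [hs₂, mul_right_comm, ← pow_two]⟩
    have h3 : s₃ ∈ SSubmonoid p l β := ⟨1, 1, by simp [hs₃]⟩
    rw [hsh]
    exact mul_mem (mul_mem (pow_mem h1 _) (pow_mem h2 _)) (pow_mem h3 _)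
  have hX := gaussSupport_of_eq_mul hpr hl' hM₀ hZ.1 hMZ
  obtain ⟨x, y, hxy⟩ := hS
  have hT : sh ∈ T0beta p l β m n := ⟨x, y, 0, 0, by simpa using hxy⟩
  have h00 : sh.val 0 0 = x := by simp [hxy]
  have h01 : sh.val 0 1 = p * β * y := by simp [hxy]
  have h10 : sh.val 1 0 = y := by simp [hxy]
  have h11 : sh.val 1 1 = x := by simp [hxy]
  have hx : (p : ZMod (p ^ l)) ^ n * (α + r * x) = 0 := h00 ▸ hX.1
  have hy : (p : ZMod (p ^ l)) ^ n * (1 + r * y) = 0 := h10 ▸ hX.2.1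
  have hy' : (p : ZMod (p ^ l)) ^ m * (p * β + r * (p * β * y)) = 0 := by
    obtain ⟨t, ht⟩ := pow_dvd_pow (p : ZMod (p ^ l)) hnm
    rw [pow_succ] at ht
    linear_combination t * β * hy + β * (1 + r * y) * ht
  simp only [aChar_eq_stdAddChar, Int.cast_one, one_mul] at hμ hψN
  have hμN := map_one_add_pow_mul hn0 (by omega) hμmul hμne hμ
  have hshift := t0Summand_mul_Nelt hm0 hl' hmn hnm r hμmul hψmul
    (fun a b c d => hψN a b c d _ (Nelt_val hm0 hl' a b c d))
  have hpow : (p : ZMod (p ^ l)) ^ m * (p : ZMod (p ^ l)) ^ (n - m) = (p : ZMod (p ^ l)) ^ n := by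
    rw [← pow_add, Nat.add_sub_cancel' hmn]
  have hsupp := sum_eq_sum_of_twist (p ^ l) (t0Summand β m n r μ ψ)
    (fun a b c d => Nelt hm0 hl' ((p : ZMod (p ^ l)) ^ (n - m) * a) b
      ((p : ZMod (p ^ l)) ^ (n - m) * c) ((p : ZMod (p ^ l)) ^ (n - m) * d))
    (fun Y => (p : ZMod (p ^ l)) ^ n * (α + r * Y.val 0 0))
    (fun Y => (p : ZMod (p ^ l)) ^ n * (1 + r * Y.val 1 0))
    (fun Y => (p : ZMod (p ^ l)) ^ n * (p * β + r * Y.val 0 1))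
    (fun Y => (p : ZMod (p ^ l)) ^ n * (α + r * Y.val 1 1)) (P := GaussSupport β n α r)
    (fun _ => Iff.rfl) (fun Y a b c d => by
      rw [hshift, diagTwist_pow_mul hl' hmn hμN, diagTwist_pow_mul hl' hmn hμN, ← hpow]
      ring_nf)
  have hcoset := sum_gaussSupport_eq hpr hm0 hl' hmn hnm hX hT (t0Summand β m n r μ ψ)
    (fun Y hY => by simp [t0Summand, hY])
  have htwist : ∀ i, ∑ t ∈ Finset.range (p ^ (n - m)), diagTwist μ r m i x (t : ZMod (p ^ l)) =
      ∑ t ∈ Finset.range (p ^ (n - m)),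
        μ (1 + (p : ZMod (p ^ l)) ^ m * (t : ZMod (p ^ l))) *
          aChar (p ^ l) 1 ((p : ZMod (p ^ l)) ^ (2 * m) * (i : ZMod (p ^ l)) * (t : ZMod (p ^ l))) *
          aChar (p ^ l) r ((p : ZMod (p ^ l)) ^ m * sh.val 0 0 * (t : ZMod (p ^ l))) := by
    intro i
    refine Finset.sum_congr rfl fun t _ => ?_
    rw [diagTwist, aChar_eq_stdAddChar, aChar_eq_stdAddChar, h00, AddChar.map_add_eq_mul,
      Int.cast_one, one_mul, ← mul_assoc (μ _)]
  rw [tauGL_mul_indC, ← htwist, ← htwist]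
  change _ * ∑ Y, t0Summand β m n r μ ψ Y = _
  rw [hsupp, hcoset]
  simp only [hshift, h00, h01, h10, h11, hy, hy', mul_zero, AddChar.map_zero_eq_one, one_mul,
    ← Finset.mul_sum, ← Finset.sum_mul, Finset.sum_const, Finset.card_range, nsmul_eq_mul,
    sum_range_diagTwist hm0 hl' hmn hμmul hμN _ hx]
  rw [t0Summand, Set.indicator_of_mem hT]
  have hexp : (p : ℂ) ^ (l + 2 * m) = p ^ m * p ^ n * p ^ m * p ^ m := by
    rw [hl']
    ring
  rw [hexp]
  push_cast
  ring
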